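/- The Hibi algebra H_{D(n,m)} over the distributive lattice D(n,m) is isomorphic as a ℂ-algebra to the semigroup ring ℂ[P_{n,m}], i.e., to the monoid algebra over ℂ of the additive monoid of order-preserving maps Γ_{n,m} → ℤ_{≥0}. -/

import Mathlib

noncomputable section

/-- One-line tableau predicate: `isTab n m I J` says `[I:J]` is a one-line tableau in `D(n,m)`,
i.e. `I ⊆ {1,…,n}` and `J ⊆ {1,…,m}` are strictly increasing sequences of the same (positive) length. -/
def isTab (n m : ℕ) (I J : List ℕ) : Prop :=
  I.length = J.length ∧ I ≠ [] ∧ I.Chain' (· < ·) ∧ J.Chain' (· < ·) ∧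
    (∀ x ∈ I, 1 ≤ x ∧ x ≤ n) ∧ ∀ x ∈ J, 1 ≤ x ∧ x ≤ m

/-- The tableau order `A ⪯ B` on one-line tableaux. -/
def tleq (A B : List ℕ × List ℕ) : Prop :=
  B.1.length ≤ A.1.length ∧
    ∀ r < B.1.length, A.1.getD r 0 ≤ B.1.getD r 0 ∧ A.2.getD r 0 ≤ B.2.getD r 0

/-- The map ξ : `ξ([I:J]) = [j₁,…,jₕ, m+u₁,…,m+u_{n−h}]` where
`{n+1−u₁,…,n+1−u_{n−h}}` is the complement of `I` in `{1,…,n}`. -/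
def xi (n m : ℕ) (I J : List ℕ) : List ℕ :=
  J ++ ((((List.range n).map (· + 1)).filter fun c => decide (c ∉ I)).reverse.map
      fun c => m + (n + 1 - c))

/-- The top element `[m+1, …, m+n]`. -/
def topL (n m : ℕ) : List ℕ := (List.range n).map fun r => m + r + 1

def xiInvI (n m : ℕ) (K : List ℕ) : List ℕ :=
  ((List.range n).map (· + 1)).filter fun i => decide (m + (n + 1 - i) ∉ K)

def xiInvJ (m : ℕ) (K : List ℕ) : List ℕ := K.filter fun x => decide (x ≤ m)

/-- The meet `A ∧ B` in the distributive lattice `D(n,m)`, computed by transporting the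
entrywise minimum through the order isomorphism ξ. -/
def tabMeet (n m : ℕ) (A B : List ℕ × List ℕ) : List ℕ × List ℕ :=
  (xiInvI n m (List.zipWith min (xi n m A.1 A.2) (xi n m B.1 B.2)),
    xiInvJ m (List.zipWith min (xi n m A.1 A.2) (xi n m B.1 B.2)))

/-- The join `A ∨ B` in the distributive lattice `D(n,m)`. -/
def tabJoin (n m : ℕ) (A B : List ℕ × List ℕ) : List ℕ × List ℕ :=
  (xiInvI n m (List.zipWith max (xi n m A.1 A.2) (xi n m B.1 B.2)),
    xiInvJ m (List.zipWith max (xi n m A.1 A.2) (xi n m B.1 B.2)))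

open Classical in
/-- The variable `z_t` of the Hibi algebra when `t` belongs to the lattice, else `0`. -/
def hVar (P : List ℕ × List ℕ → Prop) (t : List ℕ × List ℕ) : MvPolynomial {s // P s} ℂ :=
  if h : P t then MvPolynomial.X ⟨t, h⟩ else 0

/-- The Hibi ideal `(z_x z_y − z_{x∧y} z_{x∨y})` for the lattice `{s // P s}` with meet `mt`
and join `jn`; the Hibi algebra over the lattice is the corresponding quotient. -/
def hibiIdeal (P : List ℕ × List ℕ → Prop)
    (mt jn : List ℕ × List ℕ → List ℕ × List ℕ → List ℕ × List ℕ) :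
    Ideal (MvPolynomial {s // P s} ℂ) :=
  Ideal.span {f | ∃ x y : {s // P s},
    f = MvPolynomial.X x * MvPolynomial.X y - hVar P (mt x.1 y.1) * hVar P (jn x.1 y.1)}

/-- `inGT m (i,j)` : `z_j^{(i)}` is a point of the Gelfand–Tsetlin poset Γ_m. -/
def inGT (m : ℕ) (z : ℕ × ℕ) : Prop := 1 ≤ z.2 ∧ z.2 ≤ z.1 ∧ z.1 ≤ m

/-- The Gelfand–Tsetlin order: `gtLE (a,b) (i,j)` means `z_b^{(a)} ≤ z_j^{(i)}` in the partial
order generated by `z_j^{(i+1)} ≥ z_j^{(i)} ≥ z_{j+1}^{(i+1)}`. -/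
def gtLE (z w : ℕ × ℕ) : Prop := w.2 ≤ z.2 ∧ z.1 + w.2 ≤ w.1 + z.2

/-- The poset `Γ_{n,m} = Γ_{m+n}^n \\ {z : z ≥ z_n^{(m+n)}}`. -/
def GammaSet (n m : ℕ) : Set (ℕ × ℕ) :=
  {z | inGT (m + n) z ∧ z.2 ≤ n ∧ ¬ gtLE (m + n, n) z}

/-- The additive monoid of order preserving maps `S → ℤ_{≥0}` (extended by 0 off `S`),
where `S` carries the GT order. -/
def coneMonoid (S : Set (ℕ × ℕ)) : AddSubmonoid ((ℕ × ℕ) → ℕ) where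
  carrier := {q | (∀ z ∉ S, q z = 0) ∧ ∀ z w, z ∈ S → w ∈ S → gtLE z w → q z ≤ q w}
  zero_mem' := ⟨fun _ _ => rfl, fun _ _ _ _ _ => le_refl _⟩
  add_mem' := by
    rintro a b ⟨ha0, ha1⟩ ⟨hb0, hb1⟩
    refine ⟨fun z hz => ?_, fun z w hz hw h => ?_⟩
    · simp [Pi.add_apply, ha0 z hz, hb0 z hz]
    · exact add_le_add (ha1 z w hz hw h) (hb1 z w hz hw h)

/-- `K` is a strictly increasing sequence of length `n` in `{1,…,m+n}`. -/
def IsStrictSeq (n m : ℕ) (K : List ℕ) : Prop :=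
  K.Pairwise (· < ·) ∧ K.length = n ∧ ∀ x ∈ K, 1 ≤ x ∧ x ≤ m + n

lemma isTab.isStrict_left {n m : ℕ} {I J : List ℕ} (h : isTab n m I J) : I.Pairwise (· < ·) :=
  List.isChain_iff_pairwise.mp h.2.2.1

lemma isTab.isStrict_right {n m : ℕ} {I J : List ℕ} (h : isTab n m I J) : J.Pairwise (· < ·) :=
  List.isChain_iff_pairwise.mp h.2.2.2.1

lemma pairwise_lt_map_succ_range (n : ℕ) : ((List.range n).map (· + 1)).Pairwise (· < ·) := by
  rw [List.pairwise_map]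
  exact List.pairwise_lt_range.imp fun h => by omega

lemma mem_map_succ_range {n c : ℕ} : c ∈ (List.range n).map (· + 1) ↔ 1 ≤ c ∧ c ≤ n := by
  simp only [List.mem_map, List.mem_range]
  constructor
  · rintro ⟨a, ha, rfl⟩
    omega
  · intro h
    exact ⟨c - 1, by omega, by omega⟩

lemma mem_xi {n m : ℕ} {I J : List ℕ} {x : ℕ} :
    x ∈ xi n m I J ↔ x ∈ J ∨ (m < x ∧ x ≤ m + n ∧ m + n + 1 - x ∉ I) := by
  rw [xi, List.mem_append, List.mem_map]
  refine or_congr_right ⟨?_, fun h => ⟨m + n + 1 - x, ?_, by omega⟩⟩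
  · rintro ⟨c, hc, rfl⟩
    rw [List.mem_reverse, List.mem_filter, mem_map_succ_range, decide_eq_true_eq] at hc
    refine ⟨by omega, by omega, ?_⟩
    convert hc.2 using 2
    omega
  · rw [List.mem_reverse, List.mem_filter, mem_map_succ_range, decide_eq_true_eq]
    exact ⟨by omega, h.2.2⟩

lemma mem_xiInvI {n m : ℕ} {K : List ℕ} {i : ℕ} :
    i ∈ xiInvI n m K ↔ (1 ≤ i ∧ i ≤ n) ∧ m + (n + 1 - i) ∉ K := by
  simp only [xiInvI, List.mem_filter, mem_map_succ_range, decide_eq_true_eq]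

lemma mem_xiInvJ {m : ℕ} {K : List ℕ} {x : ℕ} : x ∈ xiInvJ m K ↔ x ∈ K ∧ x ≤ m := by
  simp only [xiInvJ, List.mem_filter, decide_eq_true_eq]

lemma pairwise_xiInvI (n m : ℕ) (K : List ℕ) : (xiInvI n m K).Pairwise (· < ·) :=
  (pairwise_lt_map_succ_range n).filter _

lemma pairwise_xiInvJ (m : ℕ) {K : List ℕ} (hK : K.Pairwise (· < ·)) :
    (xiInvJ m K).Pairwise (· < ·) :=
  hK.filter _

lemma pairwise_xi {n m : ℕ} {I J : List ℕ} (hJ : J.Pairwise (· < ·)) (hJm : ∀ x ∈ J, x ≤ m) :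
    (xi n m I J).Pairwise (· < ·) := by
  rw [xi, List.pairwise_append]
  refine ⟨hJ, ?_, ?_⟩
  · rw [List.pairwise_map, List.pairwise_reverse]
    refine List.Pairwise.imp_of_mem ?_ ((pairwise_lt_map_succ_range n).filter _)
    intro a b ha hb hab
    have := mem_map_succ_range.mp (List.mem_filter.mp hb).1
    omega
  · intro a ha b hb
    obtain ⟨c, hc, rfl⟩ := List.mem_map.mp hb
    have := mem_map_succ_range.mp (List.mem_filter.mp (List.mem_reverse.mp hc)).1
    have := hJm a ha
    omega

lemma length_xi {n m : ℕ} {I J : List ℕ} (hI : I.Pairwise (· < ·))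
    (hIn : ∀ x ∈ I, 1 ≤ x ∧ x ≤ n) : (xi n m I J).length + I.length = J.length + n := by
  have h1 := ((List.range n).map (· + 1)).length_eq_length_filter_add (fun c => decide (c ∈ I))
  have h2 : ((List.range n).map (· + 1)).filter (fun c => decide (c ∈ I)) = I := by
    refine ((pairwise_lt_map_succ_range n).filter _).eq_of_mem_iff hI fun {a} => ?_
    simp only [List.mem_filter, mem_map_succ_range, decide_eq_true_eq]
    exact ⟨fun h => h.2, fun h => ⟨hIn a h, h⟩⟩
  rw [h2] at h1
  simp only [xi, List.length_append, List.length_map, List.length_reverse, List.length_range,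
    decide_not] at h1 ⊢
  omega

lemma isTab.isStrictSeq_xi {n m : ℕ} {I J : List ℕ} (h : isTab n m I J) :
    IsStrictSeq n m (xi n m I J) := by
  have hl := length_xi (m := m) (J := J) h.isStrict_left h.2.2.2.2.1
  refine ⟨pairwise_xi h.isStrict_right fun x hx => (h.2.2.2.2.2 x hx).2,
    by have := h.1; omega, fun x hx => ?_⟩
  rcases mem_xi.mp hx with hx | hx
  · have := h.2.2.2.2.2 x hx
    omega
  · omega

lemma isTab.getD_xi_zero_le {n m : ℕ} {I J : List ℕ} (h : isTab n m I J) :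
    (xi n m I J).getD 0 0 ≤ m := by
  obtain ⟨hl, hI, -, -, -, hJ⟩ := h
  cases J with
  | nil => exact absurd (List.length_eq_zero_iff.mp hl) hI
  | cons a J => simpa [xi] using (hJ a (by simp)).2

lemma isTab.xiInvI_xi {n m : ℕ} {I J : List ℕ} (h : isTab n m I J) :
    xiInvI n m (xi n m I J) = I := by
  refine (pairwise_xiInvI n m _).eq_of_mem_iff h.isStrict_left fun {i} => ?_
  have hI := h.2.2.2.2.1 i
  have hJ := h.2.2.2.2.2 (m + (n + 1 - i))
  rw [mem_xiInvI, mem_xi]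
  constructor
  · rintro ⟨hi, h2⟩
    by_contra hc
    refine h2 (Or.inr ⟨by omega, by omega, ?_⟩)
    convert hc using 2
    omega
  · intro hi
    have := hI hi
    refine ⟨this, ?_⟩
    rintro (h3 | h3)
    · have := hJ h3
      omega
    · apply h3.2.2
      convert hi using 1
      omega

lemma isTab.xiInvJ_xi {n m : ℕ} {I J : List ℕ} (h : isTab n m I J) :
    xiInvJ m (xi n m I J) = J := by
  refine (pairwise_xiInvJ m h.isStrictSeq_xi.1).eq_of_mem_iff h.isStrict_right fun {i} => ?_
  have hJ := h.2.2.2.2.2 i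
  rw [mem_xiInvJ, mem_xi]
  constructor
  · rintro ⟨h1 | h1, h2⟩
    · exact h1
    · omega
  · intro hi
    exact ⟨Or.inl hi, (hJ hi).2⟩

lemma IsStrictSeq.xi_xiInv {n m : ℕ} {K : List ℕ} (hK : IsStrictSeq n m K) :
    xi n m (xiInvI n m K) (xiInvJ m K) = K := by
  refine (pairwise_xi (pairwise_xiInvJ m hK.1)
    fun x hx => (mem_xiInvJ.mp hx).2).eq_of_mem_iff hK.1 fun {x} => ?_
  have hx := hK.2.2 x
  rw [mem_xi, mem_xiInvI, mem_xiInvJ]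
  constructor
  · rintro (h | ⟨h1, h2, h3⟩)
    · exact h.1
    · by_contra hc
      refine h3 ⟨by omega, ?_⟩
      convert hc using 2
      omega
  · intro h
    by_cases hxm : x ≤ m
    · exact Or.inl ⟨h, hxm⟩
    · refine Or.inr ⟨by omega, (hx h).2, fun h3 => h3.2 ?_⟩
      convert h using 1
      have := hx h
      omega

lemma IsStrictSeq.isTab_xiInv {n m : ℕ} (hn : 0 < n) {K : List ℕ} (hK : IsStrictSeq n m K)
    (h0 : K.getD 0 0 ≤ m) : isTab n m (xiInvI n m K) (xiInvJ m K) := by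
  have hl := length_xi (m := m) (J := xiInvJ m K) (pairwise_xiInvI n m K)
    fun x hx => (mem_xiInvI.mp hx).1
  rw [hK.xi_xiInv, hK.2.1] at hl
  have hlen : (xiInvI n m K).length = (xiInvJ m K).length := by omega
  refine ⟨hlen, ?_, List.isChain_iff_pairwise.mpr (pairwise_xiInvI n m K),
    List.isChain_iff_pairwise.mpr (pairwise_xiInvJ m hK.1), fun x hx => (mem_xiInvI.mp hx).1,
    fun x hx => ⟨(hK.2.2 x (mem_xiInvJ.mp hx).1).1, (mem_xiInvJ.mp hx).2⟩⟩
  intro h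
  have hl0 : 0 < K.length := hK.2.1 ▸ hn
  rw [List.getD_eq_getElem _ _ hl0] at h0
  rw [h] at hlen
  have := List.length_pos_of_mem (mem_xiInvJ.mpr ⟨List.getElem_mem hl0, h0⟩)
  simp only [List.length_nil] at hlen
  omega

lemma IsStrictSeq.getD_mem {n m : ℕ} {K : List ℕ} (hK : IsStrictSeq n m K) {j : ℕ} (hj : j < n) :
    K.getD j 0 ∈ K := by
  rw [List.getD_eq_getElem _ _ (hK.2.1 ▸ hj)]
  exact List.getElem_mem _

lemma IsStrictSeq.getD_lt {n m : ℕ} {K : List ℕ} (hK : IsStrictSeq n m K) {i j : ℕ} (hij : i < j)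
    (hj : j < n) : K.getD i 0 < K.getD j 0 := by
  have hl := hK.2.1
  rw [List.getD_eq_getElem _ _ (by omega), List.getD_eq_getElem _ _ (by omega)]
  exact List.pairwise_iff_getElem.mp hK.1 i j _ _ hij

lemma IsStrictSeq.getD_add_le {n m : ℕ} {K : List ℕ} (hK : IsStrictSeq n m K) {i d : ℕ}
    (h : i + d < n) : K.getD i 0 + d ≤ K.getD (i + d) 0 := by
  induction d with
  | zero => rfl
  | succ d ih =>
    have := ih (by omega)
    have := hK.getD_lt (i := i + d) (j := i + (d + 1)) (by omega) h
    omega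

lemma IsStrictSeq.lt_getD {n m : ℕ} {K : List ℕ} (hK : IsStrictSeq n m K) {j : ℕ}
    (hj : j < n) : j < K.getD j 0 := by
  have h1 := hK.getD_add_le (i := 0) (d := j) (by omega)
  have h2 := hK.2.2 _ (hK.getD_mem (j := 0) (by omega))
  rw [Nat.zero_add] at h1
  omega

lemma IsStrictSeq.getD_le {n m : ℕ} {K : List ℕ} (hK : IsStrictSeq n m K) {j : ℕ}
    (hj : j < n) : K.getD j 0 ≤ m + j + 1 := by
  have h1 := hK.getD_add_le (i := j) (d := n - 1 - j) (by omega)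
  have h2 := hK.2.2 _ (hK.getD_mem (j := j + (n - 1 - j)) (by omega))
  omega

lemma isStrictSeq_map_range {n m : ℕ} {f : ℕ → ℕ} (hf : ∀ i j, i < j → j < n → f i < f j)
    (hb : ∀ j < n, 1 ≤ f j ∧ f j ≤ m + n) : IsStrictSeq n m ((List.range n).map f) := by
  refine ⟨?_, by simp, ?_⟩
  · rw [List.pairwise_map]
    exact List.pairwise_lt_range.imp_of_mem fun _ hb h => hf _ _ h (List.mem_range.mp hb)
  · intro x hx
    obtain ⟨j, hj, rfl⟩ := List.mem_map.mp hx
    exact hb j (List.mem_range.mp hj)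

lemma getD_map_range {n : ℕ} (f : ℕ → ℕ) {j : ℕ} (hj : j < n) :
    ((List.range n).map f).getD j 0 = f j := by
  simp [hj]

lemma zipWith_eq_map_range {n : ℕ} (g : ℕ → ℕ → ℕ) {K L : List ℕ} (hK : K.length = n)
    (hL : L.length = n) :
    List.zipWith g K L = (List.range n).map fun j => g (K.getD j 0) (L.getD j 0) := by
  refine List.ext_getElem (by simp [hK, hL]) fun i h1 h2 => ?_
  have hi : i < n := by simpa using h2
  rw [List.getElem_zipWith, List.getElem_map, List.getElem_range,
    List.getD_eq_getElem _ _ (hK.symm ▸ hi), List.getD_eq_getElem _ _ (hL.symm ▸ hi)]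

lemma mem_GammaSet {n m : ℕ} {z : ℕ × ℕ} :
    z ∈ GammaSet n m ↔ 1 ≤ z.2 ∧ z.2 ≤ n ∧ z.2 ≤ z.1 ∧ z.1 < m + z.2 := by
  simp only [GammaSet, inGT, gtLE, Set.mem_ofPred_eq]
  omega

/-- `A` is a nonempty up-set of `Γ_{n,m}`; nonemptiness means containing the top `z_1^{(m)}`. -/
def IsGammaFilter (n m : ℕ) (A : Set (ℕ × ℕ)) : Prop :=
  A ⊆ GammaSet n m ∧ (m, 1) ∈ A ∧ ∀ z w, z ∈ A → w ∈ GammaSet n m → gtLE z w → w ∈ A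

lemma IsGammaFilter.union {n m : ℕ} {A B : Set (ℕ × ℕ)} (hA : IsGammaFilter n m A)
    (hB : IsGammaFilter n m B) : IsGammaFilter n m (A ∪ B) :=
  ⟨Set.union_subset hA.1 hB.1, Or.inl hA.2.1, fun z w hz hw h =>
    hz.imp (fun hz => hA.2.2 z w hz hw h) fun hz => hB.2.2 z w hz hw h⟩

lemma IsGammaFilter.inter {n m : ℕ} {A B : Set (ℕ × ℕ)} (hA : IsGammaFilter n m A)
    (hB : IsGammaFilter n m B) : IsGammaFilter n m (A ∩ B) :=
  ⟨Set.inter_subset_left.trans hA.1, ⟨hA.2.1, hB.2.1⟩, fun z w hz hw h =>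
    ⟨hA.2.2 z w hz.1 hw h, hB.2.2 z w hz.2 hw h⟩⟩

/-- The up-set of `Γ_{n,m}` whose row `j` starts at the `j`-th entry of `K`. -/
def seqFilter (n m : ℕ) (K : List ℕ) : Set (ℕ × ℕ) :=
  {z | z ∈ GammaSet n m ∧ K.getD (z.2 - 1) 0 ≤ z.1}

lemma IsStrictSeq.isGammaFilter_seqFilter {n m : ℕ} (hn : 0 < n) (hm : 0 < m) {K : List ℕ}
    (hK : IsStrictSeq n m K) (h0 : K.getD 0 0 ≤ m) : IsGammaFilter n m (seqFilter n m K) := by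
  refine ⟨fun z hz => hz.1, ⟨mem_GammaSet.mpr ?_, h0⟩, ?_⟩
  · simp only
    omega
  · rintro ⟨i, j⟩ ⟨i', j'⟩ ⟨hz, h⟩ hw ⟨h1, h2⟩
    refine ⟨hw, ?_⟩
    rw [mem_GammaSet] at hz hw
    simp only at hz hw h h1 h2 ⊢
    have := hK.getD_add_le (i := j' - 1) (d := j - j') (by omega)
    rw [show j' - 1 + (j - j') = j - 1 by omega] at this
    omega

lemma IsStrictSeq.eq_of_seqFilter_eq {n m : ℕ} {K L : List ℕ} (hK : IsStrictSeq n m K)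
    (hL : IsStrictSeq n m L) (h : seqFilter n m K = seqFilter n m L) : K = L := by
  have aux : ∀ {K L : List ℕ}, IsStrictSeq n m K → IsStrictSeq n m L →
      seqFilter n m K ⊆ seqFilter n m L → ∀ j < n, L.getD j 0 ≤ K.getD j 0 := by
    intro K L hK hL h j hj
    by_contra! hlt
    have h1 := hK.lt_getD hj
    have h2 := hL.getD_le hj
    have h3 : (K.getD j 0, j + 1) ∈ seqFilter n m K :=
      ⟨mem_GammaSet.mpr (by simp only; omega), le_refl _⟩
    exact absurd (h h3).2 (not_le.mpr hlt)
  refine List.ext_getElem (hK.2.1.trans hL.2.1.symm) fun j h1 h2 => ?_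
  have hj : j < n := hK.2.1 ▸ h1
  rw [← List.getD_eq_getElem _ 0 h1, ← List.getD_eq_getElem _ 0 h2]
  exact le_antisymm (aux hL hK h.symm.subset j hj) (aux hK hL h.subset j hj)

lemma IsGammaFilter.exists_seqFilter_eq {n m : ℕ} (hn : 0 < n) {A : Set (ℕ × ℕ)}
    (hA : IsGammaFilter n m A) :
    ∃ K, IsStrictSeq n m K ∧ K.getD 0 0 ≤ m ∧ seqFilter n m K = A := by
  classical
  obtain ⟨hsub, htop, hup⟩ := hA
  have hex : ∀ j, ∃ i, j < i ∧ ((i, j + 1) ∈ A ∨ m + j + 1 ≤ i) :=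
    fun j => ⟨m + j + 1, by omega, Or.inr le_rfl⟩
  have hlt : ∀ j, j < Nat.find (hex j) := fun j => (Nat.find_spec (hex j)).1
  have hle : ∀ j, Nat.find (hex j) ≤ m + j + 1 :=
    fun j => Nat.find_min' (hex j) ⟨by omega, Or.inr le_rfl⟩
  have hmono : StrictMono fun j => Nat.find (hex j) := by
    refine strictMono_nat_of_lt_succ fun j => ?_
    have h1 := hlt (j + 1)
    have h2 : Nat.find (hex j) ≤ Nat.find (hex (j + 1)) - 1 := by
      refine Nat.find_min' (hex j) ⟨by omega, ?_⟩
      rcases (Nat.find_spec (hex (j + 1))).2 with h | h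
      · left
        have hg := mem_GammaSet.mp (hsub h)
        refine hup _ _ h (mem_GammaSet.mpr ?_) ?_
        · simp only at hg ⊢
          omega
        · simp only [gtLE]
          omega
      · right
        omega
    omega
  refine ⟨(List.range n).map fun j => Nat.find (hex j),
    isStrictSeq_map_range (fun i j h _ => hmono h) fun j hj => ?_, ?_, ?_⟩
  · have := hlt j
    have := hle j
    omega
  · rw [getD_map_range _ hn]
    refine Nat.find_min' (hex 0) ⟨?_, Or.inl htop⟩
    have := mem_GammaSet.mp (hsub htop)
    simp only at this
    omega
  · ext ⟨i, j⟩
    constructor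
    · rintro ⟨hz, h⟩
      have hg := mem_GammaSet.mp hz
      simp only at hg h
      rw [getD_map_range _ (by omega)] at h
      rcases (Nat.find_spec (hex (j - 1))).2 with h1 | h1
      · refine hup _ _ h1 hz ?_
        simp only [gtLE]
        omega
      · omega
    · intro hz
      have hg := mem_GammaSet.mp (hsub hz)
      simp only at hg
      refine ⟨hsub hz, ?_⟩
      simp only
      rw [getD_map_range _ (by omega)]
      refine Nat.find_min' (hex (j - 1)) ⟨by omega, Or.inl ?_⟩
      rwa [show j - 1 + 1 = j by omega]

lemma IsStrictSeq.zipWith_min {n m : ℕ} {K L : List ℕ} (hK : IsStrictSeq n m K)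
    (hL : IsStrictSeq n m L) : IsStrictSeq n m (List.zipWith min K L) := by
  rw [zipWith_eq_map_range min hK.2.1 hL.2.1]
  refine isStrictSeq_map_range (fun i j h hj => ?_) fun j hj => ?_
  · have := hK.getD_lt h hj
    have := hL.getD_lt h hj
    omega
  · have := hK.2.2 _ (hK.getD_mem hj)
    have := hL.2.2 _ (hL.getD_mem hj)
    omega

lemma IsStrictSeq.zipWith_max {n m : ℕ} {K L : List ℕ} (hK : IsStrictSeq n m K)
    (hL : IsStrictSeq n m L) : IsStrictSeq n m (List.zipWith max K L) := by
  rw [zipWith_eq_map_range max hK.2.1 hL.2.1]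
  refine isStrictSeq_map_range (fun i j h hj => ?_) fun j hj => ?_
  · have := hK.getD_lt h hj
    have := hL.getD_lt h hj
    omega
  · have := hK.2.2 _ (hK.getD_mem hj)
    have := hL.2.2 _ (hL.getD_mem hj)
    omega

lemma IsStrictSeq.seqFilter_zipWith_min {n m : ℕ} {K L : List ℕ} (hK : IsStrictSeq n m K)
    (hL : IsStrictSeq n m L) :
    seqFilter n m (List.zipWith min K L) = seqFilter n m K ∪ seqFilter n m L := by
  ext ⟨i, j⟩
  rw [zipWith_eq_map_range min hK.2.1 hL.2.1]
  simp only [seqFilter, Set.mem_union, Set.mem_ofPred_eq, ← and_or_left]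
  refine and_congr_right fun hz => ?_
  have hg := mem_GammaSet.mp hz
  simp only at hg
  rw [getD_map_range _ (by omega), min_le_iff]

lemma IsStrictSeq.seqFilter_zipWith_max {n m : ℕ} {K L : List ℕ} (hK : IsStrictSeq n m K)
    (hL : IsStrictSeq n m L) :
    seqFilter n m (List.zipWith max K L) = seqFilter n m K ∩ seqFilter n m L := by
  ext ⟨i, j⟩
  rw [zipWith_eq_map_range max hK.2.1 hL.2.1]
  simp only [seqFilter, Set.mem_inter_iff, Set.mem_ofPred_eq, ← and_and_left]
  refine and_congr_right fun hz => ?_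
  have hg := mem_GammaSet.mp hz
  simp only at hg
  rw [getD_map_range _ (by omega), max_le_iff]

/-- The up-set of `Γ_{n,m}` attached to a one-line tableau. -/
def tabFilter (n m : ℕ) (s : List ℕ × List ℕ) : Set (ℕ × ℕ) := seqFilter n m (xi n m s.1 s.2)

lemma isGammaFilter_tabFilter {n m : ℕ} (hn : 0 < n) (hm : 0 < m) {s : List ℕ × List ℕ}
    (hs : isTab n m s.1 s.2) : IsGammaFilter n m (tabFilter n m s) :=
  hs.isStrictSeq_xi.isGammaFilter_seqFilter hn hm hs.getD_xi_zero_le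

lemma tabFilter_injOn (n m : ℕ) :
    Set.InjOn (tabFilter n m) {s | isTab n m s.1 s.2} := by
  intro s hs t ht h
  have hs' : isTab n m s.1 s.2 := hs
  have ht' : isTab n m t.1 t.2 := ht
  have hx := hs'.isStrictSeq_xi.eq_of_seqFilter_eq ht'.isStrictSeq_xi h
  refine Prod.ext ?_ ?_
  · rw [← hs'.xiInvI_xi, hx, ht'.xiInvI_xi]
  · rw [← hs'.xiInvJ_xi, hx, ht'.xiInvJ_xi]

lemma IsGammaFilter.exists_tabFilter_eq {n m : ℕ} (hn : 0 < n) {A : Set (ℕ × ℕ)}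
    (hA : IsGammaFilter n m A) :
    ∃ t : {s : List ℕ × List ℕ // isTab n m s.1 s.2}, tabFilter n m t.1 = A := by
  obtain ⟨K, hK, h0, rfl⟩ := hA.exists_seqFilter_eq hn
  exact ⟨⟨(xiInvI n m K, xiInvJ m K), hK.isTab_xiInv hn h0⟩, by
    simp only [tabFilter, hK.xi_xiInv]⟩

lemma isTab_tabMeet {n m : ℕ} (hn : 0 < n) {s t : List ℕ × List ℕ} (hs : isTab n m s.1 s.2)
    (ht : isTab n m t.1 t.2) : isTab n m (tabMeet n m s t).1 (tabMeet n m s t).2 := by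
  refine (hs.isStrictSeq_xi.zipWith_min ht.isStrictSeq_xi).isTab_xiInv hn ?_
  rw [zipWith_eq_map_range min hs.isStrictSeq_xi.2.1 ht.isStrictSeq_xi.2.1, getD_map_range _ hn]
  exact min_le_of_left_le hs.getD_xi_zero_le

lemma isTab_tabJoin {n m : ℕ} (hn : 0 < n) {s t : List ℕ × List ℕ} (hs : isTab n m s.1 s.2)
    (ht : isTab n m t.1 t.2) : isTab n m (tabJoin n m s t).1 (tabJoin n m s t).2 := by
  refine (hs.isStrictSeq_xi.zipWith_max ht.isStrictSeq_xi).isTab_xiInv hn ?_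
  rw [zipWith_eq_map_range max hs.isStrictSeq_xi.2.1 ht.isStrictSeq_xi.2.1, getD_map_range _ hn]
  exact max_le hs.getD_xi_zero_le ht.getD_xi_zero_le

lemma tabFilter_tabMeet {n m : ℕ} {s t : List ℕ × List ℕ} (hs : isTab n m s.1 s.2)
    (ht : isTab n m t.1 t.2) :
    tabFilter n m (tabMeet n m s t) = tabFilter n m s ∪ tabFilter n m t := by
  simp only [tabFilter, tabMeet, (hs.isStrictSeq_xi.zipWith_min ht.isStrictSeq_xi).xi_xiInv,
    hs.isStrictSeq_xi.seqFilter_zipWith_min ht.isStrictSeq_xi]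

lemma tabFilter_tabJoin {n m : ℕ} {s t : List ℕ × List ℕ} (hs : isTab n m s.1 s.2)
    (ht : isTab n m t.1 t.2) :
    tabFilter n m (tabJoin n m s t) = tabFilter n m s ∩ tabFilter n m t := by
  simp only [tabFilter, tabJoin, (hs.isStrictSeq_xi.zipWith_max ht.isStrictSeq_xi).xi_xiInv,
    hs.isStrictSeq_xi.seqFilter_zipWith_max ht.isStrictSeq_xi]

/-- The characteristic function of an up-set, as an element of the lattice cone. -/
def filterIndicator {n m : ℕ} {A : Set (ℕ × ℕ)} (hA : IsGammaFilter n m A) :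
    coneMonoid (GammaSet n m) :=
  ⟨A.indicator 1, fun z hz => Set.indicator_of_notMem (fun h => hz (hA.1 h)) _,
    fun z w _ hw h => by
      by_cases hzA : z ∈ A
      · rw [Set.indicator_of_mem hzA, Set.indicator_of_mem (hA.2.2 z w hzA hw h)]
        exact le_rfl
      · rw [Set.indicator_of_notMem hzA]
        exact Nat.zero_le _⟩

lemma filterIndicator_add {n m : ℕ} {A B : Set (ℕ × ℕ)} (hA : IsGammaFilter n m A)
    (hB : IsGammaFilter n m B) :
    filterIndicator hA + filterIndicator hB =
      filterIndicator (hA.union hB) + filterIndicator (hA.inter hB) :=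
  Subtype.ext (Set.indicator_union_add_inter 1 A B).symm

/-- The superlevel set `{z ∈ Γ_{n,m} : q z ≥ k}`. -/
def gammaLevel (n m : ℕ) (q : ℕ × ℕ → ℕ) (k : ℕ) : Set (ℕ × ℕ) := {z | z ∈ GammaSet n m ∧ k ≤ q z}

lemma gtLE_top {n m : ℕ} {z : ℕ × ℕ} (hz : z ∈ GammaSet n m) : gtLE z (m, 1) := by
  rw [mem_GammaSet] at hz
  simp only [gtLE]
  omega

lemma top_mem_GammaSet {n m : ℕ} (hn : 0 < n) (hm : 0 < m) : (m, 1) ∈ GammaSet n m :=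
  mem_GammaSet.mpr (by simp only; omega)

lemma le_apply_top {n m : ℕ} (hn : 0 < n) (hm : 0 < m) (q : coneMonoid (GammaSet n m))
    {z : ℕ × ℕ} (hz : z ∈ GammaSet n m) : q.1 z ≤ q.1 (m, 1) :=
  q.2.2 z _ hz (top_mem_GammaSet hn hm) (gtLE_top hz)

lemma isGammaFilter_gammaLevel {n m : ℕ} (hn : 0 < n) (hm : 0 < m)
    (q : coneMonoid (GammaSet n m)) {k : ℕ} (hk : k ≤ q.1 (m, 1)) :
    IsGammaFilter n m (gammaLevel n m q.1 k) :=
  ⟨fun _ hz => hz.1, ⟨top_mem_GammaSet hn hm, hk⟩,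
    fun z w hz hw h => ⟨hw, hz.2.trans (q.2.2 z w hz.1 hw h)⟩⟩

lemma coneMonoid_induction {n m : ℕ} (hn : 0 < n) (hm : 0 < m)
    {p : coneMonoid (GammaSet n m) → Prop} (zero : p 0)
    (add : ∀ q A (hA : IsGammaFilter n m A), p q → p (q + filterIndicator hA))
    (q : coneMonoid (GammaSet n m)) : p q := by
  obtain ⟨N, hN⟩ : ∃ N, q.1 (m, 1) = N := ⟨_, rfl⟩
  induction N generalizing q with
  | zero =>
    convert zero
    refine Subtype.ext (funext fun z => ?_)
    by_cases hz : z ∈ GammaSet n m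
    · exact Nat.le_zero.mp (hN ▸ le_apply_top hn hm q hz)
    · exact q.2.1 z hz
  | succ N ih =>
    have hA := isGammaFilter_gammaLevel hn hm q (k := 1) (by omega)
    let r : coneMonoid (GammaSet n m) := ⟨fun z => q.1 z - 1,
      fun z hz => by simp [q.2.1 z hz],
      fun z w hz hw h => Nat.sub_le_sub_right (q.2.2 z w hz hw h) 1⟩
    have hq : q = r + filterIndicator hA := by
      refine Subtype.ext (funext fun z => ?_)
      change q.1 z = (q.1 z - 1) + (gammaLevel n m q.1 1).indicator 1 z
      by_cases hz : z ∈ gammaLevel n m q.1 1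
      · rw [Set.indicator_of_mem hz, Pi.one_apply]
        have := hz.2
        omega
      · rw [Set.indicator_of_notMem hz]
        by_cases hz' : z ∈ GammaSet n m
        · have : ¬ 1 ≤ q.1 z := fun h => hz ⟨hz', h⟩
          omega
        · have := q.2.1 z hz'
          omega
    rw [hq]
    refine add _ _ _ (ih r ?_)
    change q.1 (m, 1) - 1 = N
    omega

/-- The product of `Z` over the superlevel sets of `q`. -/
def levelProd {R : Type*} [CommMonoid R] {n m : ℕ} (Z : Set (ℕ × ℕ) → R)
    (q : coneMonoid (GammaSet n m)) : R :=
  ∏ k ∈ Finset.range (q.1 (m, 1)), Z (gammaLevel n m q.1 (k + 1))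

lemma levelProd_zero {R : Type*} [CommMonoid R] {n m : ℕ} (Z : Set (ℕ × ℕ) → R) :
    levelProd Z (0 : coneMonoid (GammaSet n m)) = 1 :=
  Finset.prod_range_zero _

lemma levelProd_add_filterIndicator {R : Type*} [CommMonoid R] {n m : ℕ} (hn : 0 < n) (hm : 0 < m)
    {Z : Set (ℕ × ℕ) → R}
    (hZ : ∀ A B, IsGammaFilter n m A → IsGammaFilter n m B → Z A * Z B = Z (A ∪ B) * Z (A ∩ B))
    (q : coneMonoid (GammaSet n m)) {A : Set (ℕ × ℕ)} (hA : IsGammaFilter n m A) :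
    levelProd Z (q + filterIndicator hA) = levelProd Z q * Z A := by
  have hval : ∀ z, (q + filterIndicator hA).1 z = q.1 z + A.indicator 1 z := fun z => rfl
  have hin : ∀ z ∈ A, (q + filterIndicator hA).1 z = q.1 z + 1 := fun z hz => by
    rw [hval, Set.indicator_of_mem hz, Pi.one_apply]
  have hout : ∀ z ∉ A, (q + filterIndicator hA).1 z = q.1 z := fun z hz => by
    rw [hval, Set.indicator_of_notMem hz, Nat.add_zero]
  have key : ∀ N ≤ q.1 (m, 1),
      (∏ k ∈ Finset.range N, Z (gammaLevel n m q.1 (k + 1))) * Z A =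
        (∏ k ∈ Finset.range N, Z (gammaLevel n m (q + filterIndicator hA).1 (k + 1))) *
          Z (A ∩ gammaLevel n m q.1 N) := by
    intro N
    induction N with
    | zero =>
      intro _
      have : A ∩ gammaLevel n m q.1 0 = A :=
        Set.inter_eq_left.mpr fun z hz => ⟨hA.1 hz, Nat.zero_le _⟩
      rw [this, Finset.prod_range_zero, Finset.prod_range_zero]
    | succ N ih =>
      intro hN
      have hU : A ∩ gammaLevel n m q.1 N ∪ gammaLevel n m q.1 (N + 1) =
          gammaLevel n m (q + filterIndicator hA).1 (N + 1) := by
        ext z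
        by_cases hz : z ∈ A
        · simp only [gammaLevel, Set.mem_union, Set.mem_inter_iff, Set.mem_ofPred_eq, hin z hz, hz,
            true_and, ← and_or_left]
          exact and_congr_right fun _ => by omega
        · simp only [gammaLevel, Set.mem_union, Set.mem_inter_iff, Set.mem_ofPred_eq, hout z hz, hz,
            false_and, false_or]
      have hI : A ∩ gammaLevel n m q.1 N ∩ gammaLevel n m q.1 (N + 1) =
          A ∩ gammaLevel n m q.1 (N + 1) := by
        rw [Set.inter_assoc]
        congr 1
        exact Set.inter_eq_right.mpr fun z hz => ⟨hz.1, (Nat.le_succ N).trans hz.2⟩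
      rw [Finset.prod_range_succ, Finset.prod_range_succ, mul_right_comm, ih (by omega), mul_assoc,
        hZ _ _ (hA.inter (isGammaFilter_gammaLevel hn hm q (by omega)))
          (isGammaFilter_gammaLevel hn hm q hN), hU, hI, mul_assoc]
  have htop : gammaLevel n m (q + filterIndicator hA).1 (q.1 (m, 1) + 1) =
      A ∩ gammaLevel n m q.1 (q.1 (m, 1)) := by
    ext z
    by_cases hz : z ∈ A
    · simp only [gammaLevel, Set.mem_inter_iff, Set.mem_ofPred_eq, hin z hz, hz, true_and]
      exact and_congr_right fun _ => by omega
    · simp only [gammaLevel, Set.mem_inter_iff, Set.mem_ofPred_eq, hout z hz, hz, false_and,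
        iff_false, not_and]
      intro hzS
      have := le_apply_top hn hm q hzS
      omega
  rw [levelProd, levelProd, key _ le_rfl, hin _ hA.2.1, Finset.prod_range_succ, htop]

lemma levelProd_add {R : Type*} [CommMonoid R] {n m : ℕ} (hn : 0 < n) (hm : 0 < m)
    {Z : Set (ℕ × ℕ) → R}
    (hZ : ∀ A B, IsGammaFilter n m A → IsGammaFilter n m B → Z A * Z B = Z (A ∪ B) * Z (A ∩ B))
    (q r : coneMonoid (GammaSet n m)) : levelProd Z (q + r) = levelProd Z q * levelProd Z r := by
  induction r using coneMonoid_induction hn hm with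
  | zero => rw [add_zero, levelProd_zero, mul_one]
  | add r A hA ih =>
    rw [← add_assoc, levelProd_add_filterIndicator hn hm hZ, ih,
      levelProd_add_filterIndicator hn hm hZ, mul_assoc]

/-- `levelProd` as a monoid homomorphism, for `Z` satisfying the Hibi relations. -/
def levelProdHom {R : Type*} [CommMonoid R] {n m : ℕ} (hn : 0 < n) (hm : 0 < m)
    {Z : Set (ℕ × ℕ) → R}
    (hZ : ∀ A B, IsGammaFilter n m A → IsGammaFilter n m B → Z A * Z B = Z (A ∪ B) * Z (A ∩ B)) :
    Multiplicative (coneMonoid (GammaSet n m)) →* R where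
  toFun q := levelProd Z q.toAdd
  map_one' := levelProd_zero Z
  map_mul' q r := levelProd_add hn hm hZ q.toAdd r.toAdd

lemma levelProdHom_filterIndicator {R : Type*} [CommMonoid R] {n m : ℕ} (hn : 0 < n) (hm : 0 < m)
    {Z : Set (ℕ × ℕ) → R}
    (hZ : ∀ A B, IsGammaFilter n m A → IsGammaFilter n m B → Z A * Z B = Z (A ∪ B) * Z (A ∩ B))
    {A : Set (ℕ × ℕ)} (hA : IsGammaFilter n m A) :
    levelProdHom hn hm hZ (.ofAdd (filterIndicator hA)) = Z A := by
  change levelProd Z (filterIndicator hA) = Z A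
  rw [← zero_add (filterIndicator hA), levelProd_add_filterIndicator hn hm hZ, levelProd_zero,
    one_mul]

lemma coneMonoid_hom_ext {R : Type*} [Monoid R] {n m : ℕ} (hn : 0 < n) (hm : 0 < m)
    {f g : Multiplicative (coneMonoid (GammaSet n m)) →* R}
    (h : ∀ A (hA : IsGammaFilter n m A),
      f (.ofAdd (filterIndicator hA)) = g (.ofAdd (filterIndicator hA))) : f = g := by
  refine MonoidHom.ext fun q => ?_
  change f (.ofAdd q.toAdd) = g (.ofAdd q.toAdd)
  induction q.toAdd using coneMonoid_induction hn hm with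
  | zero => rw [ofAdd_zero, map_one, map_one]
  | add r A hA ih => rw [ofAdd_add, map_mul, map_mul, ih, h]

/-- The generator of the Hibi algebra indexed by an up-set of `Γ_{n,m}`. -/
def filterGen (n m : ℕ) (A : Set (ℕ × ℕ)) :
    MvPolynomial {s : List ℕ × List ℕ // isTab n m s.1 s.2} ℂ ⧸
      hibiIdeal (fun s => isTab n m s.1 s.2) (tabMeet n m) (tabJoin n m) :=
  open Classical in
  if h : ∃ t : {s : List ℕ × List ℕ // isTab n m s.1 s.2}, tabFilter n m t.1 = A then
    Ideal.Quotient.mk _ (MvPolynomial.X h.choose) else 0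

lemma filterGen_tabFilter {n m : ℕ} (t : {s : List ℕ × List ℕ // isTab n m s.1 s.2}) :
    filterGen n m (tabFilter n m t.1) = Ideal.Quotient.mk _ (MvPolynomial.X t) := by
  have h : ∃ t' : {s : List ℕ × List ℕ // isTab n m s.1 s.2},
      tabFilter n m t'.1 = tabFilter n m t.1 := ⟨t, rfl⟩
  rw [filterGen, dif_pos h]
  congr 2
  exact Subtype.ext (tabFilter_injOn n m h.choose.2 t.2 h.choose_spec)

lemma filterGen_mul {n m : ℕ} (hn : 0 < n) {A B : Set (ℕ × ℕ)} (hA : IsGammaFilter n m A)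
    (hB : IsGammaFilter n m B) :
    filterGen n m A * filterGen n m B = filterGen n m (A ∪ B) * filterGen n m (A ∩ B) := by
  obtain ⟨s, rfl⟩ := hA.exists_tabFilter_eq hn
  obtain ⟨t, rfl⟩ := hB.exists_tabFilter_eq hn
  have hM := isTab_tabMeet hn s.2 t.2
  have hJ := isTab_tabJoin hn s.2 t.2
  rw [← tabFilter_tabMeet s.2 t.2, ← tabFilter_tabJoin s.2 t.2, filterGen_tabFilter,
    filterGen_tabFilter, filterGen_tabFilter ⟨_, hM⟩, filterGen_tabFilter ⟨_, hJ⟩, ← map_mul,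
    ← map_mul, Ideal.Quotient.eq]
  refine Ideal.subset_span ⟨s, t, ?_⟩
  rw [hVar, hVar, dif_pos hM, dif_pos hJ]

/-- The homomorphism from the Hibi algebra to the semigroup ring sending a tableau to the
characteristic function of its up-set. -/
def hibiToSemigroupRing {n m : ℕ} (hn : 0 < n) (hm : 0 < m) :
    (MvPolynomial {s : List ℕ × List ℕ // isTab n m s.1 s.2} ℂ ⧸
        hibiIdeal (fun s => isTab n m s.1 s.2) (tabMeet n m) (tabJoin n m)) →ₐ[ℂ]
      AddMonoidAlgebra ℂ (coneMonoid (GammaSet n m)) :=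
  Ideal.Quotient.liftₐ _
    (MvPolynomial.aeval fun t =>
      AddMonoidAlgebra.single (filterIndicator (isGammaFilter_tabFilter hn hm t.2)) 1) <| by
    intro a ha
    rw [← RingHom.mem_ker]
    revert a
    change hibiIdeal _ _ _ ≤ _
    rw [hibiIdeal, Ideal.span_le]
    rintro _ ⟨s, t, rfl⟩
    have hM := isTab_tabMeet hn s.2 t.2
    have hJ := isTab_tabJoin hn s.2 t.2
    rw [SetLike.mem_coe, RingHom.mem_ker, hVar, hVar, dif_pos hM, dif_pos hJ, map_sub, map_mul,
      map_mul, MvPolynomial.aeval_X, MvPolynomial.aeval_X, MvPolynomial.aeval_X,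
      MvPolynomial.aeval_X, AddMonoidAlgebra.single_mul_single,
      AddMonoidAlgebra.single_mul_single, filterIndicator_add, sub_eq_zero]
    congr 2
    all_goals simp only [tabFilter_tabMeet s.2 t.2, tabFilter_tabJoin s.2 t.2]

lemma hibiToSemigroupRing_filterGen {n m : ℕ} (hn : 0 < n) (hm : 0 < m) {A : Set (ℕ × ℕ)}
    (hA : IsGammaFilter n m A) :
    hibiToSemigroupRing hn hm (filterGen n m A) =
      AddMonoidAlgebra.single (filterIndicator hA) 1 := by
  obtain ⟨t, rfl⟩ := hA.exists_tabFilter_eq hn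
  rw [filterGen_tabFilter]
  exact MvPolynomial.aeval_X _ t

/-- Proposition `cone4GL`. The Hibi algebra `H_{D(n,m)}` is isomorphic as
a ℂ-algebra to the semigroup ring `ℂ[𝒫_{n,m}]`, i.e. to the monoid algebra of the additive
monoid of order preserving maps `Γ_{n,m} → ℤ_{≥0}`. -/
theorem hibi_isom_semigroup_ring (n m : ℕ) (hn : 0 < n) (hm : 0 < m) :
    Nonempty ((MvPolynomial {s : List ℕ × List ℕ // isTab n m s.1 s.2} ℂ ⧸
        hibiIdeal (fun s => isTab n m s.1 s.2) (tabMeet n m) (tabJoin n m)) ≃ₐ[ℂ]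
      AddMonoidAlgebra ℂ (coneMonoid (GammaSet n m))) := by
  let g := AddMonoidAlgebra.lift ℂ _ _
    (levelProdHom hn hm fun A B hA hB => filterGen_mul (n := n) (m := m) hn hA hB)
  have hg : ∀ A (hA : IsGammaFilter n m A),
      g (AddMonoidAlgebra.single (filterIndicator hA) 1) = filterGen n m A := fun A hA => by
    rw [AddMonoidAlgebra.lift_single, one_smul, levelProdHom_filterIndicator]
  refine ⟨AlgEquiv.ofAlgHom (hibiToSemigroupRing hn hm) g ?_ ?_⟩
  · refine (AddMonoidAlgebra.lift ℂ _ _).symm.injective (coneMonoid_hom_ext hn hm fun A hA => ?_)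
    change hibiToSemigroupRing hn hm (g (AddMonoidAlgebra.single (filterIndicator hA) 1)) =
      AddMonoidAlgebra.single (filterIndicator hA) 1
    rw [hg, hibiToSemigroupRing_filterGen]
  · refine Ideal.Quotient.algHom_ext _ (MvPolynomial.algHom_ext fun t => ?_)
    change g (hibiToSemigroupRing hn hm (Ideal.Quotient.mk _ (MvPolynomial.X t))) =
      Ideal.Quotient.mk _ (MvPolynomial.X t)
    rw [← filterGen_tabFilter,
      hibiToSemigroupRing_filterGen hn hm (isGammaFilter_tabFilter hn hm t.2), hg]

end
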